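/- In the space of homeomorphisms of a compact metric space X, equipped with the metric d(f,g) = sup_x d(f(x),g(x)) + sup_x d(f⁻¹(x),g⁻¹(x)), the set of uniquely ergodic homeomorphisms is a G_δ set. -/

import Mathlib

open MeasureTheory

lemma aux_cont {X : Type*} [MetricSpace X] [CompactSpace X]
    [MeasurableSpace X] [BorelSpace X] :
    Continuous (fun q : C(X, ℝ) × ProbabilityMeasure X => ∫ x, q.1 x ∂(q.2 : Measure X)) := by
  rw [continuous_iff_continuousAt]
  rintro ⟨ψ, μ⟩
  have h1 : Filter.Tendsto (fun q : C(X, ℝ) × ProbabilityMeasure X =>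
      ∫ x, ψ x ∂(q.2 : Measure X)) (nhds (ψ, μ)) (nhds (∫ x, ψ x ∂(μ : Measure X))) :=
    ((ProbabilityMeasure.continuous_integral_continuousMap ψ).comp continuous_snd).tendsto (ψ, μ)
  have h2 : Filter.Tendsto (fun q : C(X, ℝ) × ProbabilityMeasure X =>
      ∫ x, (q.1 - ψ) x ∂(q.2 : Measure X)) (nhds (ψ, μ)) (nhds 0) := by
    have h3 : Filter.Tendsto (fun q : C(X, ℝ) × ProbabilityMeasure X => ‖q.1 - ψ‖)
        (nhds (ψ, μ)) (nhds 0) := by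
      have : Continuous (fun q : C(X, ℝ) × ProbabilityMeasure X => ‖q.1 - ψ‖) := by fun_prop
      simpa using this.tendsto (ψ, μ)
    refine squeeze_zero_norm (fun q => ?_) h3
    have := norm_integral_le_of_norm_le_const (μ := (q.2 : Measure X))
      (Filter.Eventually.of_forall (fun x => (q.1 - ψ).norm_coe_le_norm x))
    simpa using this
  have h4 := h2.add h1
  rw [zero_add] at h4
  refine h4.congr (fun q => ?_)
  have hi : ∀ f : C(X, ℝ), Integrable (fun x => f x) (q.2 : Measure X) := fun f =>
    f.continuous.integrable_of_hasCompactSupport (HasCompactSupport.of_compactSpace _)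
  rw [← integral_add (hi _) (hi _)]
  simp

lemma aux_closed {X : Type*} [MetricSpace X] [CompactSpace X]
    [MeasurableSpace X] [BorelSpace X] :
    IsClosed {q : C(X, X) × ProbabilityMeasure X |
      MeasurePreserving ⇑q.1 (q.2 : Measure X) (q.2 : Measure X)} := by
  have : {q : C(X, X) × ProbabilityMeasure X |
      MeasurePreserving ⇑q.1 (q.2 : Measure X) (q.2 : Measure X)} =
      ⋂ φ : C(X, ℝ), {q | ∫ x, (φ.comp q.1) x ∂(q.2 : Measure X)
        = ∫ x, φ x ∂(q.2 : Measure X)} := by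
    ext ⟨f, μ⟩
    simp only [Set.mem_setOf_eq, Set.mem_iInter, ContinuousMap.comp_apply]
    have hm : ∀ φ : C(X, ℝ), ∫ x, φ x ∂((μ : Measure X).map f) =
        ∫ x, φ (f x) ∂(μ : Measure X) := fun φ =>
      integral_map f.continuous.measurable.aemeasurable
        φ.continuous.measurable.aestronglyMeasurable
    constructor
    · intro h φ
      rw [← hm, h.map_eq]
    · intro h
      refine ⟨f.continuous.measurable, ?_⟩
      have : IsProbabilityMeasure ((μ : Measure X).map f) :=
        Measure.isProbabilityMeasure_map f.continuous.measurable.aemeasurable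
      refine ext_of_forall_integral_eq_of_IsFiniteMeasure (fun φ => ?_)
      exact (hm φ.toContinuousMap).trans (h φ.toContinuousMap)
  rw [this]
  refine isClosed_iInter (fun φ => isClosed_eq ?_ ?_)
  · exact aux_cont.comp (((ContinuousMap.continuous_postcomp φ).comp continuous_fst).prodMk
      continuous_snd)
  · exact (ProbabilityMeasure.continuous_integral_continuousMap φ).comp continuous_snd

/-- In the space of homeomorphisms of a compact metric space (realized as pairs
`(f, f⁻¹)` of continuous maps with the uniform topology), the set of uniquely
ergodic homeomorphisms is a `G_δ` set. -/
theorem stmt12 {X : Type*} [MetricSpace X] [CompactSpace X]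
    [MeasurableSpace X] [BorelSpace X] :
    IsGδ {h : {p : C(X, X) × C(X, X) // ∀ x, p.1 (p.2 x) = x ∧ p.2 (p.1 x) = x} |
      ∃! μ : ProbabilityMeasure X,
        MeasurePreserving ⇑(h.val.1) (μ : Measure X) (μ : Measure X)} := by
  letI : MetricSpace (ProbabilityMeasure X) := TopologicalSpace.metrizableSpaceMetric _
  set H := {p : C(X, X) × C(X, X) // ∀ x, p.1 (p.2 x) = x ∧ p.2 (p.1 x) = x}
  let P := ProbabilityMeasure X
  let I : H → P → Prop := fun h μ => MeasurePreserving ⇑(h.val.1) (μ : Measure X) (μ : Measure X)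
  have hp : Continuous (fun h : H => h.val.1) := continuous_fst.comp continuous_subtype_val
  have hI : IsClosed {q : H × P | I q.1 q.2} :=
    aux_closed.preimage ((hp.comp continuous_fst).prodMk continuous_snd)
  have hE : IsClosed {h : H | ∃ μ, I h μ} := by
    convert isClosedMap_fst_of_compactSpace _ hI using 1
    ext h
    simp
  have hn : ∀ n : ℕ, IsClosed {h : H | ∃ μ ν, I h μ ∧ I h ν ∧ 1 / ((n : ℝ) + 1) ≤ dist μ ν} := by
    intro n
    have hc : IsClosed {q : H × (P × P) | I q.1 q.2.1 ∧ I q.1 q.2.2 ∧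
        1 / ((n : ℝ) + 1) ≤ dist q.2.1 q.2.2} := by
      refine IsClosed.inter (hI.preimage (f := fun q : H × (P × P) => (q.1, q.2.1)) (by fun_prop))
        (IsClosed.inter (hI.preimage (f := fun q : H × (P × P) => (q.1, q.2.2)) (by fun_prop))
        (isClosed_le continuous_const (continuous_dist.comp continuous_snd)))
    convert isClosedMap_fst_of_compactSpace _ hc using 1
    ext h
    simp
  have key : {h : H | ∃! μ : P, I h μ} = {h : H | ∃ μ, I h μ} ∩
      ⋂ n : ℕ, {h : H | ∃ μ ν, I h μ ∧ I h ν ∧ 1 / ((n : ℝ) + 1) ≤ dist μ ν}ᶜ := by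
    ext h
    simp only [Set.mem_inter_iff, Set.mem_iInter, Set.mem_compl_iff, Set.mem_setOf_eq]
    constructor
    · rintro ⟨μ, hμ, hu⟩
      refine ⟨⟨μ, hμ⟩, ?_⟩
      rintro n ⟨a, b, ha, hb, hd⟩
      rw [hu a ha, hu b hb, dist_self] at hd
      exact absurd hd (not_le.mpr Nat.one_div_pos_of_nat)
    · rintro ⟨⟨μ, hμ⟩, h2⟩
      refine ⟨μ, hμ, fun ν hν => ?_⟩
      by_contra hne
      obtain ⟨n, hn⟩ := exists_nat_one_div_lt (dist_pos.mpr hne)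
      exact h2 n ⟨ν, μ, hν, hμ, hn.le⟩
  change IsGδ {h : H | ∃! μ : P, I h μ}
  rw [key]
  exact hE.isGδ.inter (IsGδ.iInter fun n => (hn n).isOpen_compl.isGδ)
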